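/- arXiv:2511.02382 — 4 statements merged into one kernel-verified Lean document; each statement's English description precedes it below -/
import Mathlib

section
/- Let I be a linear order in which every subset has a least upper bound, and let J ⊆ I be a subset such that (i) J is dense above in I, and (ii) every element of J covers some element of I (has an immediate predecessor in I). Then the map f : I → LowerSet(J) defined by f(x) = {j ∈ J | j ≤ x} is an order isomorphism from I onto the set of lower sets of J ordered by inclusion. -/
/-- The lower set of `J` formed by the elements of `J` below `x`. -/
def lowerSetBelow {I : Type*} [Preorder I] (J : Set I) (x : I) : LowerSet J where
  carrier := {j : J | (j : I) ≤ x}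
  lower' := fun _ _ hba ha => le_trans hba ha

theorem lowerSetBelow_le_iff {I : Type*} [LinearOrder I] {J : Set I}
    (hdense : ∀ x₁ x₂ : I, x₁ < x₂ → ∃ y ∈ J, x₁ < y ∧ y ≤ x₂) {x y : I} :
    lowerSetBelow J x ≤ lowerSetBelow J y ↔ x ≤ y := by
  refine ⟨fun h => ?_, fun h _ hj => le_trans hj h⟩
  by_contra! hyx
  obtain ⟨z, hzJ, hyz, hzx⟩ := hdense y x hyx
  have hzy : z ≤ y := @h ⟨z, hzJ⟩ hzx
  exact hyz.not_ge hzy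

theorem lowerSetBelow_eq_of_isLUB {I : Type*} [LinearOrder I] {J : Set I}
    (hcov : ∀ y ∈ J, ∃ x : I, x ⋖ y) {S : LowerSet J} {x : I}
    (hx : IsLUB (Subtype.val '' (S : Set J)) x) : lowerSetBelow J x = S := by
  refine SetLike.ext fun j => ⟨fun hj => ?_, fun hj => hx.1 ⟨j, hj, rfl⟩⟩
  by_contra hjS
  obtain ⟨p, hp⟩ := hcov j j.2
  have hxp : x ≤ p := by
    refine hx.2 ?_
    rintro _ ⟨s, hs, rfl⟩
    refine hp.le_of_lt ?_
    by_contra! hjs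
    exact hjS (S.lower hjs hs)
  exact (hp.lt.trans_le hj).not_ge hxp

/-- if every subset of the linear order `I` has a least upper bound, and
`J ⊆ I` is dense above in `I` and each element of `J` has an immediate predecessor in `I`,
then `x ↦ {j ∈ J | j ≤ x}` is an order isomorphism from `I` onto the lower sets of `J`. -/
theorem stmt1 {I : Type*} [LinearOrder I]
    (hlub : ∀ S : Set I, ∃ x : I, IsLUB S x)
    (J : Set I)
    (hdense : ∀ x₁ x₂ : I, x₁ < x₂ → ∃ y ∈ J, x₁ < y ∧ y ≤ x₂)
    (hcov : ∀ y ∈ J, ∃ x : I, x ⋖ y) :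
    ∃ f : I ≃o LowerSet J,
      ∀ x : I, ((f x : LowerSet J) : Set J) = {j : J | (j : I) ≤ x} := by
  exact ⟨RelIso.ofSurjective
    (OrderEmbedding.ofMapLEIff (lowerSetBelow J) fun _ _ => lowerSetBelow_le_iff hdense)
    fun S => (hlub (Subtype.val '' (S : Set J))).imp fun _ hx =>
      lowerSetBelow_eq_of_isLUB hcov hx, fun _ => rfl⟩
end

section
/- Let I be a linear order. Then I is order-isomorphic to the set of lower sets (ordered by inclusion) of some linear order J if and only if every subset of I has a least upper bound in I and the set of elements of I that cover some element (the elements having an immediate predecessor) is dense above in I. -/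
universe u

theorem LowerSet.Iio_covBy_Iic {α : Type*} [LinearOrder α] (a : α) :
    LowerSet.Iio a ⋖ LowerSet.Iic a := by
  refine ⟨?_, fun S h₁ h₂ ↦ ?_⟩
  · rw [← LowerSet.coe_ssubset_coe]
    exact Set.Iio_ssubset_Iic_self
  · obtain ⟨b, hb, hba⟩ := Set.exists_of_ssubset (LowerSet.coe_ssubset_coe.2 h₁)
    exact h₂.not_ge (LowerSet.Iic_le.2 (S.lower (not_lt.1 hba) hb))

theorem LowerSet.exists_covBy_of_lt {α : Type*} [LinearOrder α] {S T : LowerSet α} (h : S < T) :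
    ∃ U : LowerSet α, (∃ V, V ⋖ U) ∧ S < U ∧ U ≤ T := by
  obtain ⟨a, haT, haS⟩ := Set.exists_of_ssubset (LowerSet.coe_ssubset_coe.2 h)
  refine ⟨LowerSet.Iic a, ⟨_, LowerSet.Iio_covBy_Iic a⟩, ?_, LowerSet.Iic_le.2 haT⟩
  exact lt_of_not_ge fun h ↦ haS (LowerSet.Iic_le.1 h)

/-- The set of elements of `P` below `i`, as a lower set of the subtype. -/
def LowerSet.subtypeIic {α : Type*} [Preorder α] (P : α → Prop) (i : α) :
    LowerSet (Subtype P) where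
  carrier := {j | (j : α) ≤ i}
  lower' _ _ hba ha := le_trans hba ha

theorem LowerSet.subtypeIic_strictMono {α : Type*} [Preorder α] {P : α → Prop}
    (hP : ∀ a b : α, a < b → ∃ y, P y ∧ a < y ∧ y ≤ b) :
    StrictMono (LowerSet.subtypeIic P) := by
  intro a b hab
  obtain ⟨y, hy, hay, hyb⟩ := hP a b hab
  refine lt_of_le_not_ge (fun (j : Subtype P) (hj : (j : α) ≤ a) ↦ hj.trans hab.le) fun h ↦ ?_
  exact hay.not_ge (h (show (⟨y, hy⟩ : Subtype P) ∈ LowerSet.subtypeIic P b from hyb))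

theorem LowerSet.subtypeIic_surjective {α : Type*} [LinearOrder α] {P : α → Prop}
    (hlub : ∀ S : Set α, ∃ x, IsLUB S x) (hP : ∀ y, P y → ∃ z, z ⋖ y) :
    Function.Surjective (LowerSet.subtypeIic P) := by
  intro S
  obtain ⟨x, hx⟩ := hlub (Subtype.val '' (S : Set (Subtype P)))
  refine ⟨x, le_antisymm (fun (j : Subtype P) (hj : (j : α) ≤ x) ↦ ?_)
    fun j hj ↦ hx.1 (Set.mem_image_of_mem _ hj)⟩
  by_contra hjS
  obtain ⟨z, hz⟩ := hP j j.2
  refine (hz.lt.trans_le hj).not_ge (hx.2 ?_)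
  rintro _ ⟨k, hk, rfl⟩
  refine hz.le_of_lt (lt_of_not_ge fun hjk ↦ hjS (S.lower hjk hk))

/-- a linear order `I` is order isomorphic to the lower sets of some linear
order `J` iff every subset of `I` has a least upper bound and the set of elements of `I`
having an immediate predecessor is dense above in `I`. -/
theorem stmt2 {I : Type u} [LinearOrder I] :
    (∃ (J : Type u) (_ : LinearOrder J), Nonempty (I ≃o LowerSet J)) ↔
      ((∀ S : Set I, ∃ x : I, IsLUB S x) ∧
        ∀ x₁ x₂ : I, x₁ < x₂ → ∃ y : I, (∃ z : I, z ⋖ y) ∧ x₁ < y ∧ y ≤ x₂) := by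
  constructor
  · rintro ⟨J, _, ⟨e⟩⟩
    refine ⟨fun S ↦ ⟨e.symm (sSup (e '' S)), ?_⟩, fun x₁ x₂ h ↦ ?_⟩
    · rw [← e.isLUB_image]
      exact isLUB_sSup _
    · obtain ⟨U, ⟨V, hVU⟩, h₁, h₂⟩ := LowerSet.exists_covBy_of_lt (e.strictMono h)
      exact ⟨e.symm U, ⟨e.symm V, (apply_covBy_apply_iff e.symm).2 hVU⟩,
        e.lt_symm_apply.2 h₁, e.symm_apply_le.2 h₂⟩
  · rintro ⟨hlub, hdense⟩
    exact ⟨{y : I // ∃ z, z ⋖ y}, inferInstance,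
      ⟨StrictMono.orderIsoOfSurjective _ (LowerSet.subtypeIic_strictMono hdense)
        (LowerSet.subtypeIic_surjective hlub fun _ ↦ id)⟩⟩
end

section
/- Let F be a field, I a linear order, and Γ an F-vector space equipped with an I-structure (δᵢ⁻, δᵢ⁺)_{i∈I}. Let Γ' be a subspace of Γ, equipped with the induced I-structure (δᵢ⁻ ∩ Γ', δᵢ⁺ ∩ Γ')_{i∈I}. Then every I-decomposition (Ψ'ᵢ)_{i∈I} of Γ' extends to an I-decomposition (Ψᵢ)_{i∈I} of Γ, i.e. one satisfying Ψ'ᵢ = Ψᵢ ∩ Γ' for every i ∈ I. -/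
/-- A subset of a linear order is well-ordered if every nonempty subset of it has a least
element. -/
def IsWellOrderedSubset {I : Type*} [LinearOrder I] (s : Set I) : Prop :=
  ∀ t ⊆ s, t.Nonempty → ∃ m ∈ t, ∀ x ∈ t, m ≤ x

theorem IsWellOrderedSubset.mono {I : Type*} [LinearOrder I] {s t : Set I}
    (ht : IsWellOrderedSubset t) (hst : s ⊆ t) : IsWellOrderedSubset s :=
  fun u hu hne => ht u (hu.trans hst) hne

/-- A set is well-ordered as soon as each of its strict initial segments is. -/
theorem isWellOrderedSubset_of_inter_Iio {I : Type*} [LinearOrder I] {s : Set I}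
    (h : ∀ i ∈ s, IsWellOrderedSubset (s ∩ Set.Iio i)) : IsWellOrderedSubset s := by
  rintro t hts ⟨i, hi⟩
  rcases (t ∩ Set.Iio i).eq_empty_or_nonempty with he | hne
  · exact ⟨i, hi, fun x hx => not_lt.1 fun hxi => he.subset ⟨hx, hxi⟩⟩
  · obtain ⟨m, hm, hmin⟩ :=
      h i (hts hi) (t ∩ Set.Iio i) (Set.inter_subset_inter_left _ hts) hne
    exact ⟨m, hm.1, fun x hx =>
      (lt_or_ge x i).elim (fun hxi => hmin x ⟨hx, hxi⟩) (hm.2.le.trans ·)⟩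

theorem IsWellOrderedSubset.union {I : Type*} [LinearOrder I] {s t : Set I}
    (hs : IsWellOrderedSubset s) (ht : IsWellOrderedSubset t) :
    IsWellOrderedSubset (s ∪ t) := by
  intro u hu hne
  rcases (u ∩ s).eq_empty_or_nonempty with he | hne'
  · exact ht u (fun x hx => (hu hx).resolve_left fun hxs => he.subset ⟨hx, hxs⟩) hne
  obtain ⟨m, hm, hmin⟩ := hs (u ∩ s) Set.inter_subset_right hne'
  rcases (u ∩ t).eq_empty_or_nonempty with he | hne''
  · exact ⟨m, hm.1, fun x hx =>
      hmin x ⟨hx, (hu hx).resolve_right fun hxt => he.subset ⟨hx, hxt⟩⟩⟩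
  obtain ⟨n, hn, hnmin⟩ := ht (u ∩ t) Set.inter_subset_right hne''
  refine ⟨min m n, ?_, fun x hx => ?_⟩
  · rcases min_choice m n with h | h <;> rw [h]
    exacts [hm.1, hn.1]
  · exact (hu hx).elim (fun h => (min_le_left m n).trans (hmin x ⟨hx, h⟩))
      fun h => (min_le_right m n).trans (hnmin x ⟨hx, h⟩)

/-- `Ψ` is a decomposition of the subspace `E` for the structure induced by `(δm, δp)`. -/
structure IsDecompositionOn {F I Γ : Type*} [Field F] [LinearOrder I] [AddCommGroup Γ]
    [Module F Γ] (δm δp : I → Submodule F Γ) (E : Submodule F Γ)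
    (Ψ : I → Submodule F Γ) : Prop where
  le : ∀ i, Ψ i ≤ E
  inf_le : ∀ i, δm i ⊓ E ≤ Ψ i
  mem_of_mem : ∀ i, ∀ x ∈ Ψ i, x ∈ δp i → x ∈ δm i
  exists_sub_mem : ∀ i, ∀ x ∈ E, ∃ p ∈ Ψ i, x - p ∈ δp i
  isWellOrderedSubset : ∀ x ∈ E, IsWellOrderedSubset {i | x ∉ Ψ i}

namespace IsDecompositionOn

variable {F I Γ : Type*} [Field F] [LinearOrder I] [AddCommGroup Γ] [Module F Γ]
  {δm δp : I → Submodule F Γ} {E E' : Submodule F Γ} {Ψ Φ : I → Submodule F Γ}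

theorem eq_inf (h : IsDecompositionOn δm δp E Ψ) (h' : IsDecompositionOn δm δp E' Φ)
    (hle : Ψ ≤ Φ) (i : I) : Ψ i = Φ i ⊓ E := by
  refine le_antisymm (le_inf (hle i) (h.le i)) fun x ⟨hx, hxE⟩ => ?_
  obtain ⟨p, hp, hd⟩ := h.exists_sub_mem i x hxE
  have hm : x - p ∈ δm i := h'.mem_of_mem i _ (sub_mem hx (hle i hp)) hd
  have := h.inf_le i ⟨hm, sub_mem hxE (h.le i hp)⟩
  simpa using add_mem this hp

theorem iSup {ι : Type*} [Nonempty ι] {E : ι → Submodule F Γ} {Ψ : ι → I → Submodule F Γ}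
    (h : ∀ k, IsDecompositionOn δm δp (E k) (Ψ k))
    (hdir : Directed (· ≤ ·) fun k => (E k, Ψ k)) :
    IsDecompositionOn δm δp (⨆ k, E k) (fun i => ⨆ k, Ψ k i) := by
  have hE : Directed (· ≤ ·) E := fun a b => (hdir a b).imp fun _ hk => ⟨hk.1.1, hk.2.1⟩
  have hΨ (i : I) : Directed (· ≤ ·) fun k => Ψ k i :=
    fun a b => (hdir a b).imp fun _ hk => ⟨hk.1.2 i, hk.2.2 i⟩
  refine ⟨fun i => iSup_mono fun k => (h k).le i, ?_, ?_, ?_, ?_⟩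
  · rintro i x ⟨hx, hxE⟩
    obtain ⟨k, hk⟩ := (Submodule.mem_iSup_of_directed _ hE).1 hxE
    exact (Submodule.mem_iSup_of_directed _ (hΨ i)).2 ⟨k, (h k).inf_le i ⟨hx, hk⟩⟩
  · intro i x hx hxp
    obtain ⟨k, hk⟩ := (Submodule.mem_iSup_of_directed _ (hΨ i)).1 hx
    exact (h k).mem_of_mem i x hk hxp
  · intro i x hx
    obtain ⟨k, hk⟩ := (Submodule.mem_iSup_of_directed _ hE).1 hx
    obtain ⟨p, hp, hd⟩ := (h k).exists_sub_mem i x hk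
    exact ⟨p, (Submodule.mem_iSup_of_directed _ (hΨ i)).2 ⟨k, hp⟩, hd⟩
  · intro x hx
    obtain ⟨k, hk⟩ := (Submodule.mem_iSup_of_directed _ hE).1 hx
    exact ((h k).isWellOrderedSubset x hk).mono fun i hi hxi =>
      hi ((Submodule.mem_iSup_of_directed _ (hΨ i)).2 ⟨k, hxi⟩)

open Classical in
/-- A decomposition of `E` extends to a decomposition of `E ⊔ F ∙ a`. -/
theorem exists_sup_span_singleton (hmp : δm ≤ δp) (hlt : ∀ i j, i < j → δp j ≤ δm i)
    (h : IsDecompositionOn δm δp E Ψ) (a : Γ) :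
    ∃ Φ, Ψ ≤ Φ ∧ IsDecompositionOn δm δp (E ⊔ Submodule.span F {a}) Φ := by
  have ha : a ∈ E ⊔ Submodule.span F {a} :=
    Submodule.mem_sup_right (Submodule.mem_span_singleton_self a)
  let Φ : I → Submodule F Γ := fun i =>
    Ψ i ⊔ (δm i ⊓ (E ⊔ Submodule.span F {a})) ⊔
      if ∃ p ∈ Ψ i, a - p ∈ δp i then ⊥ else Submodule.span F {a}
  have hΨΦ : Ψ ≤ Φ := fun i => le_sup_left.trans le_sup_left
  have hmΦ (i : I) : δm i ⊓ (E ⊔ Submodule.span F {a}) ≤ Φ i := le_sup_right.trans le_sup_left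
  have haΦ (i : I) (hi : ¬ ∃ p ∈ Ψ i, a - p ∈ δp i) : a ∈ Φ i := by
    refine Submodule.mem_sup_right ?_
    rw [if_neg hi]
    exact Submodule.mem_span_singleton_self a
  have hwo : IsWellOrderedSubset {i | a ∉ Φ i} := by
    refine isWellOrderedSubset_of_inter_Iio fun i hi => ?_
    obtain ⟨p, hp, hd⟩ := not_not.1 (mt (haΦ i) hi)
    have hpE := h.le i hp
    refine (h.isWellOrderedSubset p hpE).mono fun j ⟨hj, hji⟩ hpj => hj ?_
    have := hmΦ j ⟨hlt j i hji hd, sub_mem ha (Submodule.mem_sup_left hpE)⟩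
    simpa using add_mem this (hΨΦ j hpj)
  refine ⟨Φ, hΨΦ, ?_, hmΦ, ?_, ?_, ?_⟩
  · intro i
    refine sup_le (sup_le ((h.le i).trans le_sup_left) inf_le_right) ?_
    split_ifs
    exacts [bot_le, le_sup_right]
  · intro i x hx hxp
    obtain ⟨y, hy, z, hz, rfl⟩ := Submodule.mem_sup.1 hx
    obtain ⟨p, hp, m, hm, rfl⟩ := Submodule.mem_sup.1 hy
    have hpz : p + z ∈ δp i := by
      have := sub_mem hxp (hmp i hm.1)
      rwa [show p + m + z - m = p + z by abel] at this
    have hz0 : z = 0 := by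
      split_ifs at hz with hi
      · simpa using hz
      · obtain ⟨c, rfl⟩ := Submodule.mem_span_singleton.1 hz
        rcases eq_or_ne c 0 with rfl | hc
        · simp
        · refine absurd ⟨-(c⁻¹ • p), neg_mem (Submodule.smul_mem _ _ hp), ?_⟩ hi
          have := (δp i).smul_mem c⁻¹ hpz
          rwa [smul_add, inv_smul_smul₀ hc, add_comm, ← sub_neg_eq_add] at this
    subst hz0
    rw [add_zero] at hpz ⊢
    exact add_mem (h.mem_of_mem i p hp hpz) hm.1
  · intro i x hx
    obtain ⟨e, he, z, hz, rfl⟩ := Submodule.mem_sup.1 hx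
    obtain ⟨c, rfl⟩ := Submodule.mem_span_singleton.1 hz
    obtain ⟨p, hp, hd⟩ := h.exists_sub_mem i e he
    obtain ⟨q, hq, hqd⟩ : ∃ q ∈ Φ i, a - q ∈ δp i := by
      by_cases hi : ∃ p ∈ Ψ i, a - p ∈ δp i
      · obtain ⟨q, hq, hqd⟩ := hi
        exact ⟨q, hΨΦ i hq, hqd⟩
      · exact ⟨a, haΦ i hi, by simp⟩
    refine ⟨p + c • q, add_mem (hΨΦ i hp) (Submodule.smul_mem _ _ hq), ?_⟩
    rw [add_sub_add_comm, ← smul_sub]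
    exact add_mem hd (Submodule.smul_mem _ _ hqd)
  · intro x hx
    obtain ⟨e, he, z, hz, rfl⟩ := Submodule.mem_sup.1 hx
    obtain ⟨c, rfl⟩ := Submodule.mem_span_singleton.1 hz
    refine ((h.isWellOrderedSubset e he).union hwo).mono fun i hi => ?_
    by_contra hcon
    simp only [Set.mem_union, Set.mem_ofPred_eq, not_or, not_not] at hcon
    exact hi (add_mem (hΨΦ i hcon.1) (Submodule.smul_mem _ _ hcon.2))

theorem exists_extension_top (hmp : δm ≤ δp) (hlt : ∀ i j, i < j → δp j ≤ δm i)
    (h : IsDecompositionOn δm δp E Ψ) :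
    ∃ Φ, Ψ ≤ Φ ∧ IsDecompositionOn δm δp ⊤ Φ := by
  obtain ⟨⟨M, Φ⟩, hle, hmax⟩ := zorn_le_nonempty₀
    {q : Submodule F Γ × (I → Submodule F Γ) | IsDecompositionOn δm δp q.1 q.2}
    (fun c hc hchain y hy => by
      have : Nonempty c := ⟨⟨y, hy⟩⟩
      refine ⟨(⨆ k : c, k.1.1, fun i => ⨆ k : c, k.1.2 i),
        IsDecompositionOn.iSup (fun k : c => hc k.2) hchain.directed, fun z hz => ?_⟩
      exact ⟨le_iSup (fun k : c => k.1.1) ⟨z, hz⟩,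
        fun i => le_iSup (fun k : c => k.1.2 i) ⟨z, hz⟩⟩)
    (E, Ψ) h
  refine ⟨Φ, hle.2, ?_⟩
  have hM : IsDecompositionOn δm δp M Φ := hmax.prop
  have htop : M = ⊤ := by
    refine eq_top_iff.2 fun a _ => ?_
    obtain ⟨Φ', hΦ', hd⟩ := hM.exists_sup_span_singleton hmp hlt a
    have := hmax.le_of_ge (y := (M ⊔ Submodule.span F {a}, Φ')) hd ⟨le_sup_left, hΦ'⟩
    exact this.1 (Submodule.mem_sup_right (Submodule.mem_span_singleton_self a))
  exact htop ▸ hM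

end IsDecompositionOn

/-- let `Γ` be an `F`-vector space with an `I`-structure `(δm i, δp i)`, and let
`Γ'` be a subspace with the induced `I`-structure `(δm i ⊓ Γ', δp i ⊓ Γ')`.  Every
`I`-decomposition `Ψ'` of `Γ'` extends to an `I`-decomposition `Ψ` of `Γ`,
i.e. with `Ψ' i = Ψ i ⊓ Γ'` for all `i`. -/
theorem stmt3 {F : Type*} [Field F] {I : Type*} [LinearOrder I]
    {Γ : Type*} [AddCommGroup Γ] [Module F Γ]
    (δm δp : I → Submodule F Γ)
    (h1 : ∀ i, δm i ≤ δp i)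
    (h2 : ∀ i j, i < j → δp j ≤ δm i)
    (h3 : ∀ ξ : Γ, ξ ≠ 0 → ∃ i, ξ ∈ δp i ∧ ξ ∉ δm i)
    (Γ' : Submodule F Γ)
    (Ψ' : I → Submodule F Γ)
    (hΨ'le : ∀ i, Ψ' i ≤ Γ')
    (hd1 : ∀ i, δm i ⊓ Γ' = (δp i ⊓ Γ') ⊓ Ψ' i)
    (hd2 : ∀ i, Γ' = (δp i ⊓ Γ') ⊔ Ψ' i)
    (hd3 : ∀ ξ ∈ Γ', IsWellOrderedSubset {i : I | ξ ∉ Ψ' i}) :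
    ∃ Ψ : I → Submodule F Γ,
      (∀ i, δm i = δp i ⊓ Ψ i) ∧
      (∀ i, δp i ⊔ Ψ i = (⊤ : Submodule F Γ)) ∧
      (∀ ξ : Γ, IsWellOrderedSubset {i : I | ξ ∉ Ψ i}) ∧
      (∀ i, Ψ' i = Ψ i ⊓ Γ') := by
  have h : IsDecompositionOn δm δp Γ' Ψ' := by
    refine ⟨hΨ'le, fun i => (hd1 i).le.trans inf_le_right, fun i x hx hxp => ?_,
      fun i x hx => ?_, hd3⟩
    · exact ((hd1 i).ge ⟨⟨hxp, hΨ'le i hx⟩, hx⟩).1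
    · obtain ⟨d, hd, p, hp, rfl⟩ := Submodule.mem_sup.1 ((hd2 i).le hx)
      exact ⟨p, hp, by simpa using hd.1⟩
  obtain ⟨Ψ, hle, hΨ⟩ := h.exists_extension_top h1 h2
  refine ⟨Ψ, fun i => ?_, fun i => ?_, fun ξ => hΨ.isWellOrderedSubset ξ trivial,
    h.eq_inf hΨ hle⟩
  · exact le_antisymm (le_inf (h1 i) fun x hx => hΨ.inf_le i ⟨hx, trivial⟩)
      fun x hx => hΨ.mem_of_mem i x hx.2 hx.1
  · refine eq_top_iff.2 fun x _ => ?_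
    obtain ⟨p, hp, hd⟩ := hΨ.exists_sub_mem i x trivial
    exact Submodule.mem_sup.2 ⟨x - p, hd, p, hp, by simp⟩
end

section
/- Let F be a field, I a linear order, and Γ an F-vector space equipped with an I-structure (δᵢ⁻, δᵢ⁺)_{i∈I}. Then there exists a family of F-linear maps vᵢ : Γ → δᵢ⁺/δᵢ⁻ (i ∈ I) such that: (a) for each i, the restriction of vᵢ to the subspace δᵢ⁺ is the canonical quotient map δᵢ⁺ → δᵢ⁺/δᵢ⁻; (b) for every ξ ∈ Γ, the set {i ∈ I | vᵢ(ξ) ≠ 0}, with the order induced from I, is well-ordered. Moreover the resulting map ξ ↦ (vᵢ(ξ))_{i∈I} from Γ into the product ∏_{i∈I} δᵢ⁺/δᵢ⁻ is injective. -/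
/-- The positions of the topmost nonzero coordinates, with respect to `b`, of the nonzero vectors
of `U`. -/
def leadingIndices {F Γ ι : Type*} [Field F] [AddCommGroup Γ] [Module F Γ] [LinearOrder ι]
    (b : Module.Basis ι F Γ) (U : Submodule F Γ) : Set ι :=
  {β | ∃ x ∈ U, b.repr x β ≠ 0 ∧ ∀ γ, β < γ → b.repr x γ = 0}

section LeadingIndices

variable {F Γ ι : Type*} [Field F] [AddCommGroup Γ] [Module F Γ] [LinearOrder ι]
  (b : Module.Basis ι F Γ)

theorem exists_top_coordinate {x : Γ} (hx : x ≠ 0) :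
    ∃ β, b.repr x β ≠ 0 ∧ ∀ γ, β < γ → b.repr x γ = 0 := by
  have hne : (b.repr x).support.Nonempty := by simpa using hx
  refine ⟨(b.repr x).support.max' hne,
    Finsupp.mem_support_iff.1 (Finset.max'_mem _ hne), fun γ hγ => ?_⟩
  by_contra h
  exact not_le_of_gt hγ (Finset.le_max' _ _ (Finsupp.mem_support_iff.2 h))

theorem isCompl_span_compl_leadingIndices [WellFoundedLT ι] (U : Submodule F Γ) :
    IsCompl U (Submodule.span F (b '' (leadingIndices b U)ᶜ)) := by
  constructor
  · rw [Submodule.disjoint_def]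
    intro x hxU hx
    by_contra h0
    obtain ⟨β, hβ, htop⟩ := exists_top_coordinate b h0
    exact b.mem_span_image.1 hx (Finsupp.mem_support_iff.2 hβ) ⟨x, hxU, hβ, htop⟩
  · rw [codisjoint_iff, eq_top_iff, ← b.span_eq, Submodule.span_le]
    rintro _ ⟨β, rfl⟩
    induction β using WellFoundedLT.induction with
    | ind β ih =>
    by_cases hβ : β ∈ leadingIndices b U
    · obtain ⟨x, hxU, hx, htop⟩ := hβ
      have hlow : x - b.repr x β • b β ∈ Submodule.span F (b '' Set.Iio β) := by
        rw [b.mem_span_image]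
        intro γ hγ
        by_contra hlt
        rcases (not_lt.1 hlt).eq_or_lt with rfl | hlt
        · simp at hγ
        · simp [htop γ hlt, hlt.ne] at hγ
      have hle : Submodule.span F (b '' Set.Iio β) ≤
          U ⊔ Submodule.span F (b '' (leadingIndices b U)ᶜ) :=
        Submodule.span_le.2 (Set.image_subset_iff.2 fun α hα => ih α hα)
      have hmem := sub_mem (Submodule.mem_sup_left hxU) (hle hlow)
      rw [sub_sub_cancel] at hmem
      exact (Submodule.smul_mem_iff _ hx).1 hmem
    · exact Submodule.mem_sup_right (Submodule.subset_span ⟨β, hβ, rfl⟩)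

/-- Let `U ≤ W`, let `p ∈ U` and `r ∈ W`, and let `s` lie in the span of the basis vectors outside
the leading indices of `W`. If `p + q = r + s`, then either `p = r` or `s` lies lexicographically
below `q`. -/
theorem eq_or_lex_of_le {U W : Submodule F Γ} (h : U ≤ W) (p q r s : Γ)
    (hsum : p + q = r + s) (hp : p ∈ U) (hr : r ∈ W)
    (hs : s ∈ Submodule.span F (b '' (leadingIndices b W)ᶜ)) :
    p = r ∨ Finsupp.Lex (· > ·) (fun x y : F => x = 0 ∧ y ≠ 0) (b.repr s) (b.repr q) := by
  refine or_iff_not_imp_left.2 fun hne => ?_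
  have hdiff : r - p = q - s := by
    rw [sub_eq_sub_iff_add_eq_add, ← hsum, add_comm]
  obtain ⟨β, hβ, htop⟩ := exists_top_coordinate b (sub_ne_zero.2 (Ne.symm hne))
  have hlead : β ∈ leadingIndices b W := ⟨_, sub_mem hr (h hp), hβ, htop⟩
  have hzero : b.repr s β = 0 := by
    by_contra h0
    exact b.mem_span_image.1 hs (Finsupp.mem_support_iff.2 h0) hlead
  rw [hdiff] at hβ htop
  refine ⟨β, fun γ hγ => ?_, hzero, ?_⟩
  · exact (sub_eq_zero.1 (by simpa using htop γ hγ)).symm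
  · simpa [hzero] using hβ

theorem wellFounded_finsuppLex_zero [WellFoundedLT ι] :
    WellFounded (Finsupp.Lex (α := ι) (· > ·) fun x y : F => x = 0 ∧ y ≠ 0) := by
  refine Finsupp.Lex.wellFounded' (fun _ h => h.2 rfl) ?_ wellFounded_lt
  have hacc : Acc (fun x y : F => x = 0 ∧ y ≠ 0) 0 := ⟨_, fun _ h => absurd rfl h.2⟩
  exact ⟨fun _ => ⟨_, fun _ h => h.1 ▸ hacc⟩⟩

end LeadingIndices

/-- for an `F`-vector space `Γ` with an `I`-structure `(δm i, δp i)` there is a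
family of linear maps `v i : Γ → δp i ⧸ δm i` restricting on `δp i` to the canonical quotient
maps, such that for each `ξ` the set `{i | v i ξ ≠ 0}` is well-ordered, and the induced map
into the product is injective. -/
theorem stmt4 {F : Type*} [Field F] {I : Type*} [LinearOrder I]
    {Γ : Type*} [AddCommGroup Γ] [Module F Γ]
    (δm δp : I → Submodule F Γ)
    (h1 : ∀ i, δm i ≤ δp i)
    (h2 : ∀ i j, i < j → δp j ≤ δm i)
    (h3 : ∀ ξ : Γ, ξ ≠ 0 → ∃ i, ξ ∈ δp i ∧ ξ ∉ δm i) :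
    ∃ v : (i : I) → Γ →ₗ[F] (δp i ⧸ (δm i).comap (δp i).subtype),
      (∀ i : I, ∀ x : δp i, v i (x : Γ) = Submodule.Quotient.mk x) ∧
      (∀ ξ : Γ, IsWellOrderedSubset {i : I | v i ξ ≠ 0}) ∧
      Function.Injective (fun (ξ : Γ) (i : I) => v i ξ) := by
  obtain ⟨_, _⟩ := exists_wellFoundedLT (Module.Basis.ofVectorSpaceIndex F Γ)
  let b := Module.Basis.ofVectorSpace F Γ
  have hc := fun i => isCompl_span_compl_leadingIndices b (δp i)
  have hv (i : I) (x : δp i) :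
      ((δm i).comap (δp i).subtype).mkQ ((δp i).projectionOnto _ (hc i) x) =
        Submodule.Quotient.mk x := by simp
  refine ⟨fun i => ((δm i).comap (δp i).subtype).mkQ ∘ₗ (δp i).projectionOnto _ (hc i),
    hv, fun ξ t ht hne => ?_, ?_⟩
  · let q (i : I) : Γ := ξ - (δp i).projection _ (hc i) ξ
    have hq (i : I) : q i ∈ Submodule.span F (b '' (leadingIndices b (δp i))ᶜ) := by
      rw [← Submodule.projection_apply_eq_zero_iff (hc i), map_sub,
        Submodule.projection_apply_of_mem_left (hc i)
          (Submodule.projection_apply_mem (hc i) ξ), sub_self]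
    obtain ⟨m, hm, hmin⟩ :=
      (InvImage.wf (fun i => b.repr (q i)) (wellFounded_finsuppLex_zero (F := F))).has_min t hne
    refine ⟨m, hm, fun j hj => not_lt.1 fun hlt => ?_⟩
    have hle := h2 j m hlt
    rcases eq_or_lex_of_le b (hle.trans (h1 j)) ((δp m).projection _ (hc m) ξ) (q m)
      ((δp j).projection _ (hc j) ξ) (q j) (by simp only [q, add_sub_cancel])
      (Submodule.projection_apply_mem _ _) (Submodule.projection_apply_mem _ _) (hq j)
      with heq | hlex
    · refine ht hj ((Submodule.Quotient.mk_eq_zero _).2 ?_)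
      rw [Submodule.mem_comap, Submodule.subtype_apply, Submodule.coe_projectionOnto_apply, ← heq]
      exact hle (Submodule.projection_apply_mem _ _)
    · exact hmin j hj hlex
  · intro ξ η h
    by_contra hne
    obtain ⟨i, hp, hm⟩ := h3 (ξ - η) (sub_ne_zero.2 hne)
    have hmk := hv i ⟨ξ - η, hp⟩
    have hi : ((δm i).comap (δp i).subtype).mkQ ((δp i).projectionOnto _ (hc i) ξ) =
        ((δm i).comap (δp i).subtype).mkQ ((δp i).projectionOnto _ (hc i) η) := congrFun h i
    rw [map_sub, map_sub, hi, sub_self] at hmk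
    exact hm ((Submodule.Quotient.mk_eq_zero ((δm i).comap (δp i).subtype)).1 hmk.symm)
end
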